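/- Let n ≥ 1, i ∈ {1,…,n}, and let a = (a₁,…,a_r) and b = (b₁,…,b_m) be (i,n)-segments in general position with r ≥ m. If {a₁,…,a_r} ∩ {b₁,…,b_m} ≠ ∅, then {b₁,…,b_m} ⊆ {a₁,…,a_r}. -/

import Mathlib

/-- `S_{i,n} = {2j : 1 ≤ j ≤ min(i, n+1-i)} ⊆ ℤ`. -/
def Sseg (i n : ℕ) : Set ℤ :=
  {x | ∃ j : ℕ, 1 ≤ j ∧ j ≤ min i (n + 1 - i) ∧ x = 2 * (j : ℤ)}

/-- `(a 1, …, a r)` is an `(i,n)`-segment: consecutive differences lie in `S_{i,n}`. -/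
def IsSeg (i n r : ℕ) (a : ℕ → ℤ) : Prop :=
  ∀ p : ℕ, 2 ≤ p → p ≤ r → a p - a (p - 1) ∈ Sseg i n

/-- Two `(i,n)`-segments `(a 1,…,a r)` and `(b 1,…,b s)` are in general position:
there is no `(i,n)`-segment of length `> max r s` all of whose entries lie in the
union of the entries of `a` and of `b`. -/
def GenPos (i n r : ℕ) (a : ℕ → ℤ) (s : ℕ) (b : ℕ → ℤ) : Prop :=
  ¬ ∃ (t : ℕ) (c : ℕ → ℤ), max r s < t ∧ IsSeg i n t c ∧
      ∀ q : ℕ, 1 ≤ q → q ≤ t →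
        ((∃ p : ℕ, 1 ≤ p ∧ p ≤ r ∧ a p = c q) ∨ (∃ p : ℕ, 1 ≤ p ∧ p ≤ s ∧ b p = c q))

lemma seg_iff {i n : ℕ} (x : ℤ) : x ∈ Sseg i n ↔
    0 < x ∧ x ≤ 2 * ((min i (n + 1 - i) : ℕ) : ℤ) ∧ x % 2 = 0 := by
  unfold Sseg
  generalize min i (n + 1 - i) = M
  constructor
  · rintro ⟨j, h1, h2, rfl⟩
    omega
  · rintro ⟨h1, h2, h3⟩
    exact ⟨(x / 2).toNat, by omega, by omega, by omega⟩

lemma seg_mono {i n r : ℕ} {a : ℕ → ℤ} (ha : IsSeg i n r a) (p : ℕ) (hp : 1 ≤ p) (d : ℕ)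
    (hd : p + d ≤ r) : a p + d ≤ a (p + d) ∧ (a (p + d) - a p) % 2 = 0 := by
  induction d with
  | zero => simp
  | succ d ih =>
    have h1 := ih (by omega)
    have h2 := (seg_iff _).1 (ha (p + (d + 1)) (by omega) hd)
    have h3 : p + (d + 1) - 1 = p + d := by omega
    rw [h3] at h2
    push_cast
    omega

lemma seg_lt {i n r : ℕ} {a : ℕ → ℤ} (ha : IsSeg i n r a) {p q : ℕ} (hp : 1 ≤ p) (hpq : p < q)
    (hq : q ≤ r) : a p < a q := by
  obtain ⟨d, rfl⟩ := Nat.exists_eq_add_of_lt hpq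
  have := (seg_mono ha p hp (d + 1) (by omega)).1
  rw [← add_assoc] at this
  push_cast at this
  omega

lemma seg_le {i n r : ℕ} {a : ℕ → ℤ} (ha : IsSeg i n r a) {p q : ℕ} (hp : 1 ≤ p) (hpq : p ≤ q)
    (hq : q ≤ r) : a p ≤ a q := by
  rcases hpq.eq_or_lt with rfl | h
  · exact le_rfl
  · exact (seg_lt ha hp h hq).le

lemma seg_par {i n r : ℕ} {a : ℕ → ℤ} (ha : IsSeg i n r a) {p q : ℕ} (hp : 1 ≤ p) (hp' : p ≤ r)
    (hq : 1 ≤ q) (hq' : q ≤ r) : (a p - a q) % 2 = 0 := by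
  have h1 := (seg_mono ha 1 le_rfl (p - 1) (by omega)).2
  have h2 := (seg_mono ha 1 le_rfl (q - 1) (by omega)).2
  rw [show 1 + (p - 1) = p by omega] at h1
  rw [show 1 + (q - 1) = q by omega] at h2
  omega

lemma gap_same {i n r : ℕ} {a : ℕ → ℤ} (ha : IsSeg i n r a) {p : ℕ} {y : ℤ} (hp : 1 ≤ p)
    (hp' : p < r) (hno : ∀ k, 1 ≤ k → k ≤ r → a k ≤ a p ∨ y ≤ a k) :
    y - a p ≤ 2 * ((min i (n + 1 - i) : ℕ) : ℤ) := by
  have h1 := seg_lt ha hp (Nat.lt_succ_self p) hp'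
  have h2 := hno (p + 1) (by omega) (by omega)
  have h3 := (seg_iff _).1 (ha (p + 1) (by omega) hp')
  rw [Nat.add_sub_cancel] at h3
  simp only [Nat.succ_eq_add_one] at h1
  omega

lemma gap_mixed {i n r m : ℕ} {a b : ℕ → ℤ} (ha : IsSeg i n r a) (hb : IsSeg i n m b)
    {p0 q0 : ℕ} (h1 : 1 ≤ p0) (h2 : p0 ≤ r) (h3 : 1 ≤ q0) (h4 : q0 ≤ m) (h0 : a p0 = b q0)
    {p q : ℕ} (hp : 1 ≤ p) (hp' : p ≤ r) (hq : 1 ≤ q) (hq' : q ≤ m) (hlt : a p < b q)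
    (hna : ∀ k, 1 ≤ k → k ≤ r → a k ≤ a p ∨ b q ≤ a k)
    (hnb : ∀ k, 1 ≤ k → k ≤ m → b k ≤ a p ∨ b q ≤ b k) :
    b q - a p ∈ Sseg i n := by
  rw [seg_iff]
  have e1 := seg_par ha hp hp' h1 h2
  have e2 := seg_par hb hq hq' h3 h4
  refine ⟨by omega, ?_, by omega⟩
  by_cases c : p < r
  · exact gap_same ha hp c hna
  by_cases d : q = 1
  · have := seg_le ha h1 (show p0 ≤ p by omega) hp'
    have := seg_le hb hq (show q ≤ q0 by omega) h4
    omega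
  · have f1 := seg_lt hb (show 1 ≤ q - 1 by omega) (show q - 1 < q by omega) hq'
    have f2 := hnb (q - 1) (by omega) (by omega)
    have f3 := (seg_iff _).1 (hb q (by omega) hq')
    omega

lemma gap_pure {i n r : ℕ} {a : ℕ → ℤ} (ha : IsSeg i n r a)
    {p q : ℕ} (hp : 1 ≤ p) (hp' : p ≤ r) (hq : 1 ≤ q) (hq' : q ≤ r) (hlt : a p < a q)
    (hna : ∀ k, 1 ≤ k → k ≤ r → a k ≤ a p ∨ a q ≤ a k) :
    a q - a p ∈ Sseg i n :=
  gap_mixed ha ha hp hp' hp hp' rfl hp hp' hq hq' hlt hna hna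

theorem stmt3 (n i : ℕ) (hn : 1 ≤ n) (hi1 : 1 ≤ i) (hi2 : i ≤ n)
    (r m : ℕ) (hm : 1 ≤ m) (hrm : m ≤ r)
    (a b : ℕ → ℤ) (ha : IsSeg i n r a) (hb : IsSeg i n m b)
    (hgen : GenPos i n r a m b)
    (hmeet : ∃ x : ℤ, (∃ p : ℕ, 1 ≤ p ∧ p ≤ r ∧ a p = x) ∧
                       (∃ q : ℕ, 1 ≤ q ∧ q ≤ m ∧ b q = x)) :
    ∀ q : ℕ, 1 ≤ q → q ≤ m → ∃ p : ℕ, 1 ≤ p ∧ p ≤ r ∧ a p = b q := by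
  obtain ⟨x0, ⟨p0, h1, h2, h5⟩, q0, h3, h4, h6⟩ := hmeet
  have h0 : a p0 = b q0 := by rw [h5, h6]
  intro q hq hq'
  by_contra hcon
  push Not at hcon
  apply hgen
  let A : Finset ℤ := (Finset.Icc 1 r).image a
  let U : Finset ℤ := A ∪ (Finset.Icc 1 m).image b
  have hU : ∀ x, x ∈ U ↔ (∃ p : ℕ, 1 ≤ p ∧ p ≤ r ∧ a p = x) ∨
      (∃ p : ℕ, 1 ≤ p ∧ p ≤ m ∧ b p = x) := by
    intro x
    simp only [U, A, Finset.mem_union, Finset.mem_image, Finset.mem_Icc, and_assoc]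
  have hA : A.card = r := by
    rw [Finset.card_image_of_injOn, Nat.card_Icc, Nat.add_sub_cancel]
    intro x hx y hy hxy
    simp only [Finset.coe_Icc, Set.mem_Icc] at hx hy
    rcases lt_trichotomy x y with h | h | h
    · have := seg_lt ha hx.1 h hy.2
      omega
    · exact h
    · have := seg_lt ha hy.1 h hx.2
      omega
  have hlt : r < U.card := by
    rw [← hA]
    apply Finset.card_lt_card
    rw [Finset.ssubset_iff_of_subset Finset.subset_union_left]
    refine ⟨b q, (hU _).2 (Or.inr ⟨q, hq, hq', rfl⟩), ?_⟩
    simp only [A, Finset.mem_image, Finset.mem_Icc, not_exists]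
    rintro p ⟨⟨u, v⟩, w⟩
    exact hcon p u v w
  let e := U.orderIsoOfFin rfl
  let c : ℕ → ℤ := fun k => if h : k - 1 < U.card then (e ⟨k - 1, h⟩ : ℤ) else 0
  have hc : ∀ k (h : k - 1 < U.card), c k = e ⟨k - 1, h⟩ := fun k h => dif_pos h
  have hgap : ∀ x ∈ U, ∀ y ∈ U, x < y → (∀ z ∈ U, z ≤ x ∨ y ≤ z) → y - x ∈ Sseg i n := by
    intro x hx y hy hxy hz
    have za : ∀ k, 1 ≤ k → k ≤ r → a k ≤ x ∨ y ≤ a k :=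
      fun k u v => hz _ ((hU _).2 (Or.inl ⟨k, u, v, rfl⟩))
    have zb : ∀ k, 1 ≤ k → k ≤ m → b k ≤ x ∨ y ≤ b k :=
      fun k u v => hz _ ((hU _).2 (Or.inr ⟨k, u, v, rfl⟩))
    rcases (hU x).1 hx with ⟨s, s1, s2, rfl⟩ | ⟨s, s1, s2, rfl⟩ <;>
    rcases (hU y).1 hy with ⟨t, t1, t2, rfl⟩ | ⟨t, t1, t2, rfl⟩
    · exact gap_pure ha s1 s2 t1 t2 hxy za
    · exact gap_mixed ha hb h1 h2 h3 h4 h0 s1 s2 t1 t2 hxy za zb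
    · exact gap_mixed hb ha h3 h4 h1 h2 h0.symm s1 s2 t1 t2 hxy zb za
    · exact gap_pure hb s1 s2 t1 t2 hxy zb
  refine ⟨U.card, c, by omega, ?_, ?_⟩
  · intro k hk hk'
    rw [hc k (by omega), hc (k - 1) (by omega)]
    apply hgap _ (e _).2 _ (e _).2
    · rw [Subtype.coe_lt_coe, e.lt_iff_lt, Fin.mk_lt_mk]
      omega
    · intro z hz
      obtain ⟨w, hw⟩ := e.surjective ⟨z, hz⟩
      have hw' : z = (e w : ℤ) := by rw [hw]
      rw [hw', Subtype.coe_le_coe, Subtype.coe_le_coe, e.le_iff_le, e.le_iff_le, Fin.le_def,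
        Fin.le_def]
      simp only
      omega
  · intro k hk hk'
    rw [← hU, hc k (by omega)]
    exact (e _).2
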